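/- arXiv:math/0402053 — 2 statements merged into one kernel-verified Lean document; each statement's English description precedes it below -/
import Mathlib

section
/- Let X = (x₁,…,xₙ) be a vector configuration spanning ℝ^d, d ≥ 2, such that every (d−2)-dimensional linear subspace of ℝ^d spanned by a subset of {x₁,…,xₙ} is contained in exactly 2 or 3 (d−1)-dimensional linear subspaces spanned by subsets of {x₁,…,xₙ}. Let L ⊆ ℤⁿ be the lattice generated by the cocircuits of X. Then span_ℝ(L) has dimension d and L is a zonotopal lattice. -/
/-- The support of an integer vector: the set of its nonzero coordinates. -/
def supp {n : ℕ} (v : Fin n → ℤ) : Set (Fin n) := {i | v i ≠ 0}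

/-- `v` is an elementary vector of the lattice `L ⊆ ℤⁿ`: it is a nonzero lattice
vector with entries in `{-1,0,+1}` whose support is minimal among supports of
nonzero lattice vectors. -/
def IsElementary {n : ℕ} (L : AddSubgroup (Fin n → ℤ)) (v : Fin n → ℤ) : Prop :=
  v ∈ L ∧ v ≠ 0 ∧ (∀ i, v i = -1 ∨ v i = 0 ∨ v i = 1) ∧
    ∀ u ∈ L, u ≠ 0 → ¬ (supp u ⊂ supp v)

/-- A lattice `L ⊆ ℤⁿ` is zonotopal if every nonzero lattice vector's support
contains the support of some elementary vector. -/
def IsZonotopal {n : ℕ} (L : AddSubgroup (Fin n → ℤ)) : Prop :=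
  ∀ v ∈ L, v ≠ 0 → ∃ u, IsElementary L u ∧ supp u ⊆ supp v

/-- The weighted inner product on `ℝⁿ` with weights `lam`. -/
def wip {n : ℕ} (lam : Fin n → ℝ) (x y : Fin n → ℝ) : ℝ := ∑ i, lam i * x i * y i

/-- Coordinatewise cast of an integer vector to a real vector. -/
def icast {n : ℕ} (v : Fin n → ℤ) : Fin n → ℝ := fun i => (v i : ℝ)

/-- The real span `F` of a lattice `L ⊆ ℤⁿ`. -/
def latticeSpan {n : ℕ} (L : AddSubgroup (Fin n → ℤ)) : Submodule ℝ (Fin n → ℝ) :=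
  Submodule.span ℝ (icast '' (L : Set (Fin n → ℤ)))

/-- The Dirichlet-Voronoi polytope of a lattice `L ⊆ ℤⁿ` with respect to the
weighted inner product with weights `lam`. -/
def DV {n : ℕ} (L : AddSubgroup (Fin n → ℤ)) (lam : Fin n → ℝ) : Set (Fin n → ℝ) :=
  {x | x ∈ latticeSpan L ∧
    ∀ v ∈ L, wip lam x (icast v) ≤ wip lam (icast v) (icast v) / 2}

/-- `v` is a strict Voronoi vector of `L` with respect to the weighted inner
product with weights `lam`: `±v` are the unique shortest vectors of `v + 2L`. -/
def IsStrictVoronoi {n : ℕ} (L : AddSubgroup (Fin n → ℤ)) (lam : Fin n → ℝ)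
    (v : Fin n → ℤ) : Prop :=
  v ∈ L ∧ v ≠ 0 ∧ ∀ w ∈ L, v + 2 • w ≠ v → v + 2 • w ≠ -v →
    wip lam (icast v) (icast v) <
      wip lam (icast (v + 2 • w)) (icast (v + 2 • w))

/-- Two integer vectors are conformal if their entries never have opposite signs. -/
def IsConformal {n : ℕ} (v w : Fin n → ℤ) : Prop := ∀ i, 0 ≤ v i * w i

/-- The sign of a real number, as an integer in `{-1,0,+1}`. -/
noncomputable def sgnR (t : ℝ) : ℤ := if 0 < t then 1 else if t < 0 then -1 else 0

/-- A covector of the vector configuration `X`: the sign vector of the values of a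
linear functional on the configuration. -/
def IsCovector {n d : ℕ} (X : Fin n → Fin d → ℝ) (s : Fin n → ℤ) : Prop :=
  ∃ f : (Fin d → ℝ) →ₗ[ℝ] ℝ, ∀ i, s i = sgnR (f (X i))

/-- A cocircuit of the vector configuration `X`: a nonzero covector of minimal support. -/
def IsCocircuit {n d : ℕ} (X : Fin n → Fin d → ℝ) (s : Fin n → ℤ) : Prop :=
  IsCovector X s ∧ s ≠ 0 ∧ ∀ t, IsCovector X t → t ≠ 0 → ¬ (supp t ⊂ supp s)

/-- The lattice in `ℤⁿ` generated by the cocircuits of `X`. -/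
def cocircuitLattice {n d : ℕ} (X : Fin n → Fin d → ℝ) : AddSubgroup (Fin n → ℤ) :=
  AddSubgroup.closure {s | IsCocircuit X s}

/-- A linear subspace of `ℝ^d` spanned by a subset of the configuration `X`. -/
def SpannedSubspace {n d : ℕ} (X : Fin n → Fin d → ℝ)
    (W : Submodule ℝ (Fin d → ℝ)) : Prop :=
  ∃ S : Set (Fin n), W = Submodule.span ℝ (X '' S)

/-- McMullen's condition (II): every `(d-2)`-dimensional subspace spanned by vectors
of `X` is contained in exactly `2` or `3` hyperplanes spanned by vectors of `X`. -/
def ConditionII {n d : ℕ} (X : Fin n → Fin d → ℝ) : Prop :=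
  ∀ W : Submodule ℝ (Fin d → ℝ), SpannedSubspace X W → Module.finrank ℝ W = d - 2 →
    {H : Submodule ℝ (Fin d → ℝ) |
        SpannedSubspace X H ∧ Module.finrank ℝ H = d - 1 ∧ W ≤ H}.ncard = 2 ∨
    {H : Submodule ℝ (Fin d → ℝ) |
        SpannedSubspace X H ∧ Module.finrank ℝ H = d - 1 ∧ W ≤ H}.ncard = 3

/-- The zonotope generated by the vector configuration `X`, i.e. the Minkowski sum
of the segments `conv{xᵢ, -xᵢ}`. -/
def zonotope {n d : ℕ} (X : Fin n → Fin d → ℝ) : Set (Fin d → ℝ) :=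
  {z | ∃ c : Fin n → ℝ, (∀ i, |c i| ≤ 1) ∧ z = ∑ i, c i • X i}

/-- `P` tiles `ℝ^d` face-to-face by translations: some family of translates of `P`
covers `ℝ^d`, and any two distinct translates intersect in a common (possibly empty)
exposed face. -/
def TilesFaceToFace {d : ℕ} (P : Set (Fin d → ℝ)) : Prop :=
  ∃ T : Set (Fin d → ℝ),
    (∀ x, ∃ t ∈ T, x ∈ (t + ·) '' P) ∧
    ∀ s ∈ T, ∀ t ∈ T, s ≠ t →
      IsExposed ℝ ((s + ·) '' P) (((s + ·) '' P) ∩ ((t + ·) '' P)) ∧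
      IsExposed ℝ ((t + ·) '' P) (((s + ·) '' P) ∩ ((t + ·) '' P))

lemma sgnR_zero : sgnR 0 = 0 := by simp [sgnR]

lemma sgnR_one : sgnR 1 = 1 := by simp [sgnR]

lemma sgnR_eq_zero {t : ℝ} : sgnR t = 0 ↔ t = 0 := by
  unfold sgnR
  constructor
  · intro h
    split_ifs at h with h1 h2
    · omega
    · exact le_antisymm (not_lt.1 h1) (not_lt.1 h2)
  · rintro rfl
    simp

lemma sgnR_mul (a t : ℝ) : sgnR (a * t) = sgnR a * sgnR t := by
  unfold sgnR
  rcases lt_trichotomy a 0 with ha | rfl | ha <;> rcases lt_trichotomy t 0 with ht | rfl | ht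
  · have := mul_pos_of_neg_of_neg ha ht
    simp [*, not_lt.2 ha.le, not_lt.2 ht.le]
  · simp
  · have := mul_neg_of_neg_of_pos ha ht
    simp [*, not_lt.2 ha.le, not_lt.2 this.le]
  · simp
  · simp
  · simp
  · have := mul_neg_of_pos_of_neg ha ht
    simp [*, not_lt.2 ht.le, not_lt.2 this.le]
  · simp
  · have := mul_pos ha ht
    simp [*]

lemma sgnR_cases (t : ℝ) : sgnR t = -1 ∨ sgnR t = 0 ∨ sgnR t = 1 := by
  unfold sgnR
  split_ifs <;> simp

lemma sgnR_add (a b : ℝ) (h : a = 0 ∨ b = 0 ∨ a + b = 0) :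
    sgnR (a + b) = sgnR a + sgnR b := by
  rcases h with rfl | rfl | h
  · simp [sgnR_zero]
  · simp [sgnR_zero]
  · have : b = (-1) * a := by linarith
    subst this
    rw [h, sgnR_mul, sgnR_zero]
    have : sgnR (-1) = -1 := by norm_num [sgnR]
    rw [this]; ring

/-- Sign vectors of the coordinate functionals of a basis. -/
noncomputable def fund {n d : ℕ} (X : Fin n → Fin d → ℝ)
    (b : Module.Basis (Fin d) ℝ (Fin d → ℝ)) (j : Fin d) : Fin n → ℤ :=
  fun i => sgnR (b.coord j (X i))

section
variable {n d : ℕ} (X : Fin n → Fin d → ℝ)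

lemma fund_self (b : Module.Basis (Fin d) ℝ (Fin d → ℝ)) (B : Fin d → Fin n)
    (hb : ∀ j, b j = X (B j)) (j k : Fin d) : fund X b j (B k) = if k = j then 1 else 0 := by
  unfold fund
  rw [← hb, Module.Basis.coord_apply, Module.Basis.repr_self, Finsupp.single_apply]
  split_ifs <;> simp [sgnR_zero, sgnR_one]

/-- A family with a dual family of functionals is a basis with those coordinates. -/
lemma basis_of_dual (x : Fin d → Fin d → ℝ) (g : Fin d → (Fin d → ℝ) →ₗ[ℝ] ℝ)
    (h : ∀ i j, g i (x j) = if j = i then 1 else 0) :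
    ∃ b : Module.Basis (Fin d) ℝ (Fin d → ℝ), (∀ j, b j = x j) ∧ ∀ j, b.coord j = g j := by
  have hli : LinearIndependent ℝ x := by
    rw [Fintype.linearIndependent_iff]
    intro c hc i
    have := congrArg (g i) hc
    simpa [map_sum, h] using this
  let b := basisOfLinearIndependentOfCardEqFinrank' x hli (by simp)
  have hb : ∀ j, b j = x j := by intro j; simp [b]
  refine ⟨b, hb, fun j => ?_⟩
  apply b.ext
  intro i
  rw [Module.Basis.coord_apply, Module.Basis.repr_self, Finsupp.single_apply, hb, h]

lemma exists_basis (hX : Submodule.span ℝ (Set.range X) = ⊤) :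
    ∃ (B : Fin d → Fin n) (b : Module.Basis (Fin d) ℝ (Fin d → ℝ)), ∀ j, b j = X (B j) := by
  obtain ⟨s, hs, hspan, hli⟩ := exists_linearIndependent ℝ (Set.range X)
  let b0 := Module.Basis.mk hli (by rw [Subtype.range_coe, hspan, hX])
  haveI : Finite s := (Set.finite_range X).subset hs
  haveI := Fintype.ofFinite s
  have hc : Fintype.card s = d := by
    have := Module.finrank_eq_card_basis b0
    simpa using this.symm
  let b := b0.reindex (Fintype.equivFinOfCardEq hc)
  have : ∀ j, ∃ i, X i = b j := by
    intro j
    have : b j ∈ s := by simp [b, b0]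
    exact hs this
  choose B hB using this
  exact ⟨B, b, fun j => (hB j).symm⟩

/-- Basis exchange. -/
lemma exchange (b : Module.Basis (Fin d) ℝ (Fin d → ℝ)) (B : Fin d → Fin n)
    (hb : ∀ j, b j = X (B j)) (k : Fin d) (e : Fin n) (he : b.coord k (X e) ≠ 0) :
    ∃ b' : Module.Basis (Fin d) ℝ (Fin d → ℝ), (∀ j, b' j = X (Function.update B k e j)) ∧
      b'.coord k = (b.coord k (X e))⁻¹ • b.coord k ∧
      ∀ j, j ≠ k → b'.coord j =
        b.coord j + (-(b.coord j (X e) / b.coord k (X e))) • b.coord k := by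
  obtain ⟨b', h1, h2⟩ := basis_of_dual (fun j => X (Function.update B k e j))
    (fun j => if j = k then (b.coord k (X e))⁻¹ • b.coord k else
      b.coord j + (-(b.coord j (X e) / b.coord k (X e))) • b.coord k) (by
      intro i j
      have hc : ∀ p q, b.coord p (X (B q)) = if q = p then 1 else 0 := by
        intro p q
        rw [← hb, Module.Basis.coord_apply, Module.Basis.repr_self, Finsupp.single_apply]
      generalize b.coord = C at *
      by_cases hi : i = k <;> by_cases hj : j = k
      · subst hi; subst hj; simp [he]
      · subst hi; simp [hj, hc]
      · subst hj
        simp only [hi, if_false, Function.update_self, LinearMap.add_apply, LinearMap.smul_apply,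
          smul_eq_mul, Ne.symm hi]
        field_simp
        ring
      · simp [hi, hj, hc])
  refine ⟨b', h1, ?_, ?_⟩
  · rw [h2]; simp
  · intro j hj; rw [h2]; simp [hj]

/-- Consequence of condition (II). -/
lemma key (hd : 2 ≤ d) (hII : ConditionII X) (b : Module.Basis (Fin d) ℝ (Fin d → ℝ))
    (B : Fin d → Fin n)
    (hb : ∀ j, b j = X (B j)) (j k : Fin d) (hjk : j ≠ k) (e i : Fin n)
    (hj : b.coord j (X e) ≠ 0) (hk : b.coord k (X e) ≠ 0) :
    b.coord j (X i) = 0 ∨ b.coord k (X i) = 0 ∨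
      b.coord j (X i) * b.coord k (X e) = b.coord k (X i) * b.coord j (X e) := by
  by_contra hcon
  push Not at hcon
  obtain ⟨h1, h2, h3⟩ := hcon
  have hc : ∀ p q, b.coord p (X (B q)) = if q = p then 1 else 0 := by
    intro p q
    rw [← hb, Module.Basis.coord_apply, Module.Basis.repr_self, Finsupp.single_apply]
  set S : Set (Fin d) := {j, k}ᶜ with hS
  set W : Submodule ℝ (Fin d → ℝ) := Submodule.span ℝ (X '' (B '' S)) with hW
  have hWb : W = Submodule.span ℝ (Set.range (fun s : S => b s)) := by
    rw [hW]; congr 1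
    ext y; simp [hb]
  have hWr : Module.finrank ℝ W = d - 2 := by
    have hli : LinearIndependent ℝ (fun s : S => b s) :=
      b.linearIndependent.comp _ Subtype.val_injective
    rw [hWb, finrank_span_eq_card hli]
    have hcompl := Set.ncard_add_ncard_compl ({j, k} : Set (Fin d))
    rw [Set.ncard_pair hjk, ← hS, Nat.card_eq_fintype_card, Fintype.card_fin] at hcompl
    rw [← Nat.card_eq_fintype_card, Nat.card_coe_set_eq]
    omega
  have hW0 : ∀ p, p = j ∨ p = k → ∀ w ∈ W, b.coord p w = 0 := by
    intro p hp w hw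
    have : W ≤ LinearMap.ker (b.coord p) := by
      rw [hW, Submodule.span_le]
      rintro _ ⟨_, ⟨q, hq, rfl⟩, rfl⟩
      simp only [SetLike.mem_coe, LinearMap.mem_ker, hc]
      rw [if_neg]
      rintro rfl
      apply hq
      simpa using hp
    exact this hw
  set T := {H : Submodule ℝ (Fin d → ℝ) |
        SpannedSubspace X H ∧ Module.finrank ℝ H = d - 1 ∧ W ≤ H} with hT
  have hTc : T.ncard = 2 ∨ T.ncard = 3 := hII W ⟨_, hW⟩ hWr
  have hTfin : T.Finite := Set.finite_of_ncard_ne_zero (by omega)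
  let H : Fin n → Submodule ℝ (Fin d → ℝ) := fun a => W ⊔ Submodule.span ℝ {X a}
  have hHT : ∀ a, (b.coord j (X a) ≠ 0 ∨ b.coord k (X a) ≠ 0) → H a ∈ T := by
    intro a ha
    have haW : X a ∉ W := by
      intro hm
      rcases ha with ha | ha
      · exact ha (hW0 _ (Or.inl rfl) _ hm)
      · exact ha (hW0 _ (Or.inr rfl) _ hm)
    refine ⟨⟨(B '' S) ∪ {a}, ?_⟩, ?_, le_sup_left⟩
    · simp only [H, hW]
      rw [Set.image_union, Submodule.span_union, Set.image_singleton]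
    · have hx0 : X a ≠ 0 := by
        intro h; apply haW; rw [h]; exact W.zero_mem
      have hdis : W ⊓ Submodule.span ℝ {X a} = ⊥ := by
        rw [← disjoint_iff, Submodule.disjoint_span_singleton' hx0]
        exact haW
      have := Submodule.finrank_sup_add_finrank_inf_eq W (Submodule.span ℝ {X a})
      rw [hdis, finrank_bot, hWr, finrank_span_singleton hx0] at this
      change Module.finrank ℝ (W ⊔ Submodule.span ℝ {X a} : Submodule ℝ (Fin d → ℝ)) = d - 1
      omega
  have hHeq : ∀ a c, H a = H c →
      b.coord j (X a) * b.coord k (X c) = b.coord k (X a) * b.coord j (X c) := by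
    intro a c hac
    have : X a ∈ H c := by
      rw [← hac]
      exact Submodule.mem_sup_right (Submodule.mem_span_singleton_self _)
    obtain ⟨w, hw, y, hy, hwy⟩ := Submodule.mem_sup.1 this
    obtain ⟨t, rfl⟩ := Submodule.mem_span_singleton.1 hy
    rw [← hwy, map_add, map_add, hW0 _ (Or.inl rfl) _ hw, hW0 _ (Or.inr rfl) _ hw]
    simp only [map_smul, smul_eq_mul, zero_add]
    ring
  have e1 : H (B j) ≠ H (B k) := by
    intro h; have := hHeq _ _ h; simp [hc, hjk, hjk.symm] at this
  have e2 : H (B j) ≠ H e := by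
    intro h; have := hHeq _ _ h; rw [hc, hc] at this; simp [hjk] at this; exact hk this
  have e3 : H (B j) ≠ H i := by
    intro h; have := hHeq _ _ h; rw [hc, hc] at this; simp [hjk] at this; exact h2 this
  have e4 : H (B k) ≠ H e := by
    intro h; have := hHeq _ _ h; rw [hc, hc] at this; simp [hjk.symm] at this; exact hj this.symm
  have e5 : H (B k) ≠ H i := by
    intro h; have := hHeq _ _ h; rw [hc, hc] at this; simp [hjk.symm] at this; exact h1 this.symm
  have e6 : H e ≠ H i := by
    intro h; exact h3 (hHeq _ _ h.symm)
  have hsub : ({H (B j), H (B k), H e, H i} : Set _) ⊆ T := by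
    intro y hy
    rcases hy with rfl | rfl | rfl | rfl
    · exact hHT _ (Or.inl (by simp [hc]))
    · exact hHT _ (Or.inr (by simp [hc]))
    · exact hHT _ (Or.inl hj)
    · exact hHT _ (Or.inl h1)
  have hle := Set.ncard_le_ncard hsub hTfin
  have h4 : ({H (B j), H (B k), H e, H i} : Set (Submodule ℝ (Fin d → ℝ))).ncard = 4 := by
    rw [Set.ncard_insert_of_notMem (by simp [e1, e2, e3]),
      Set.ncard_insert_of_notMem (by simp [e4, e5]), Set.ncard_pair e6]
  omega

lemma smul_mem_closure {s : Set (Fin n → ℤ)} {v : Fin n → ℤ} (m : ℤ)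
    (hv : v ∈ AddSubgroup.closure s) : (fun i => m * v i) ∈ AddSubgroup.closure s := by
  have := (AddSubgroup.closure s).zsmul_mem hv m
  have h : (fun i => m * v i) = m • v := by ext i; simp
  rw [h]; exact this

lemma exchange_le (hd : 2 ≤ d) (hII : ConditionII X)
    (b b' : Module.Basis (Fin d) ℝ (Fin d → ℝ)) (B : Fin d → Fin n)
    (hb : ∀ j, b j = X (B j)) (k : Fin d) (e : Fin n) (he : b.coord k (X e) ≠ 0)
    (h1 : b'.coord k = (b.coord k (X e))⁻¹ • b.coord k)
    (h2 : ∀ j, j ≠ k → b'.coord j =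
        b.coord j + (-(b.coord j (X e) / b.coord k (X e))) • b.coord k) :
    AddSubgroup.closure (Set.range (fund X b')) ≤ AddSubgroup.closure (Set.range (fund X b)) := by
  rw [AddSubgroup.closure_le]
  rintro _ ⟨j, rfl⟩
  have hm : ∀ j, fund X b j ∈ AddSubgroup.closure (Set.range (fund X b)) :=
    fun j => AddSubgroup.subset_closure ⟨j, rfl⟩
  by_cases hj : j = k
  · subst hj
    have : fund X b' j = fun i => sgnR (b.coord j (X e))⁻¹ * fund X b j i := by
      ext i
      simp only [fund, h1]
      rw [← sgnR_mul]; rfl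
    rw [this]
    exact smul_mem_closure _ (hm j)
  · have : fund X b' j = fund X b j +
        fun i => sgnR (-(b.coord j (X e) / b.coord k (X e))) * fund X b k i := by
      ext i
      simp only [fund, Pi.add_apply]
      rw [h2 j hj, ← sgnR_mul, ← sgnR_add]
      · rfl
      · by_cases h0 : b.coord j (X e) = 0
        · right; left; rw [h0]; simp
        · rcases key X hd hII b B hb j k hj e i h0 he with h | h | h
          · left; exact h
          · right; left; rw [h]; simp
          · right; right
            field_simp
            linarith
    rw [this]
    exact add_mem (hm j) (smul_mem_closure _ (hm k))

lemma functional_eq (b : Module.Basis (Fin d) ℝ (Fin d → ℝ)) (f : (Fin d → ℝ) →ₗ[ℝ] ℝ)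
    (k : Fin d) (h : ∀ j, j ≠ k → f (b j) = 0) : f = f (b k) • b.coord k := by
  apply b.ext
  intro j
  rw [LinearMap.smul_apply, Module.Basis.coord_apply, Module.Basis.repr_self,
    Finsupp.single_apply]
  by_cases hj : j = k
  · subst hj; simp
  · simp [hj, h j hj]

lemma cocircuit_mem (hd : 2 ≤ d) (hII : ConditionII X) (s : Fin n → ℤ) (hs : IsCocircuit X s)
    (f : (Fin d → ℝ) →ₗ[ℝ] ℝ) (hf : ∀ i, s i = sgnR (f (X i))) (m : ℕ) :
    ∀ (b : Module.Basis (Fin d) ℝ (Fin d → ℝ)) (B : Fin d → Fin n),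
      (∀ j, b j = X (B j)) → (Finset.univ.filter (fun j => f (b j) ≠ 0)).card ≤ m →
      s ∈ AddSubgroup.closure (Set.range (fund X b)) := by
  classical
  induction m with
  | zero =>
    intro b B hb hm
    exfalso
    apply hs.2.1
    have : f = 0 := by
      apply b.ext
      intro j
      by_contra h
      have : j ∈ Finset.univ.filter (fun j => f (b j) ≠ 0) := by simpa using h
      have := Finset.card_pos.2 ⟨j, this⟩
      omega
    ext i
    rw [hf, this]; simp [sgnR_zero]
  | succ m ih =>
    intro b B hb hm
    have hne : ∃ k, f (b k) ≠ 0 := by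
      by_contra hcon
      push Not at hcon
      have : f = 0 := b.ext (by simpa using hcon)
      exact hs.2.1 (by ext i; rw [hf, this]; simp [sgnR_zero])
    obtain ⟨k, hk⟩ := hne
    by_cases hone : ∀ j, j ≠ k → f (b j) = 0
    · have hfe := functional_eq b f k hone
      have : s = fun i => sgnR (f (b k)) * fund X b k i := by
        ext i
        rw [hf]
        conv_lhs => rw [hfe]
        simp only [fund]
        rw [← sgnR_mul]; rfl
      rw [this]
      exact smul_mem_closure _ (AddSubgroup.subset_closure ⟨k, rfl⟩)
    · push Not at hone
      obtain ⟨l, hlk, hl⟩ := hone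
      have hex : ∃ e, f (X e) = 0 ∧ b.coord k (X e) ≠ 0 := by
        by_contra hcon
        push Not at hcon
        have hcov : IsCovector X (fund X b k) := ⟨b.coord k, fun i => rfl⟩
        refine hs.2.2 _ hcov ?_ ?_
        · intro h
          have := congrFun h (B k)
          rw [fund_self X b B hb] at this
          simp at this
        · refine ⟨?_, ?_⟩
          · intro i hi hsi
            rw [hf, sgnR_eq_zero] at hsi
            exact hi (sgnR_eq_zero.2 (hcon i hsi))
          · intro hsub
            have : B l ∈ supp s := by
              intro h
              rw [hf, sgnR_eq_zero, ← hb] at h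
              exact hl h
            exact hsub this (by rw [fund_self X b B hb, if_neg hlk])
      obtain ⟨e, hfe, hke⟩ := hex
      obtain ⟨b', hb', h1, h2⟩ := exchange X b B hb k e hke
      refine exchange_le X hd hII b b' B hb k e hke h1 h2 (ih b' _ hb' ?_)
      have hss : Finset.univ.filter (fun j => f (b' j) ≠ 0) ⊂
          Finset.univ.filter (fun j => f (b j) ≠ 0) := by
        rw [Finset.ssubset_iff_of_subset]
        · refine ⟨k, by simpa using hk, ?_⟩
          simp [hb', hfe]
        · intro j hj
          simp only [Finset.mem_filter, Finset.mem_univ, true_and] at hj ⊢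
          by_cases hjk : j = k
          · subst hjk; exact hk
          · rw [hb', Function.update_of_ne hjk, ← hb] at hj
            exact hj
      have := Finset.card_lt_card hss
      omega

lemma fund_isCocircuit (b : Module.Basis (Fin d) ℝ (Fin d → ℝ)) (B : Fin d → Fin n)
    (hb : ∀ j, b j = X (B j)) (k : Fin d) : IsCocircuit X (fund X b k) := by
  refine ⟨⟨b.coord k, fun i => rfl⟩, ?_, ?_⟩
  · intro h
    have := congrFun h (B k)
    rw [fund_self X b B hb] at this
    simp at this
  · rintro t ⟨g, hg⟩ ht hsub
    have hge := functional_eq b g k (by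
      intro j hj
      by_contra h
      have : B j ∈ supp t := by
        intro h0
        rw [hg, sgnR_eq_zero, ← hb] at h0
        exact h h0
      exact hsub.1 this (by rw [fund_self X b B hb, if_neg hj]))
    apply hsub.2
    intro i hi h0
    rw [hg, sgnR_eq_zero, hge, LinearMap.smul_apply, smul_eq_mul, mul_eq_zero] at h0
    rcases h0 with h0 | h0
    · apply ht
      ext i
      rw [hg, hge, h0]; simp [sgnR_zero]
    · exact hi (sgnR_eq_zero.2 h0)

lemma lattice_eq (hd : 2 ≤ d) (hII : ConditionII X)
    (b : Module.Basis (Fin d) ℝ (Fin d → ℝ)) (B : Fin d → Fin n)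
    (hb : ∀ j, b j = X (B j)) :
    cocircuitLattice X = AddSubgroup.closure (Set.range (fund X b)) := by
  apply le_antisymm
  · unfold cocircuitLattice
    rw [AddSubgroup.closure_le]
    intro s hs
    obtain ⟨f, hf⟩ := hs.1
    exact cocircuit_mem X hd hII s hs f hf _ b B hb le_rfl
  · rw [AddSubgroup.closure_le]
    rintro _ ⟨k, rfl⟩
    exact AddSubgroup.subset_closure (fund_isCocircuit X b B hb k)

lemma lattice_repr (hd : 2 ≤ d) (hII : ConditionII X)
    (b : Module.Basis (Fin d) ℝ (Fin d → ℝ)) (B : Fin d → Fin n)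
    (hb : ∀ j, b j = X (B j)) (v : Fin n → ℤ) (hv : v ∈ cocircuitLattice X) :
    ∀ i, v i = ∑ j, v (B j) * fund X b j i := by
  rw [lattice_eq X hd hII b B hb] at hv
  induction hv using AddSubgroup.closure_induction with
  | mem x hx =>
    obtain ⟨k, rfl⟩ := hx
    intro i
    simp [fund_self X b B hb]
  | zero => simp
  | add x y _ _ hx hy =>
    intro i
    simp only [Pi.add_apply, add_mul, Finset.sum_add_distrib]
    rw [← hx, ← hy]
  | neg x _ hx =>
    intro i
    simp only [Pi.neg_apply, neg_mul, Finset.sum_neg_distrib]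
    rw [← hx]

lemma span_dim (hd : 2 ≤ d) (hII : ConditionII X)
    (b : Module.Basis (Fin d) ℝ (Fin d → ℝ)) (B : Fin d → Fin n)
    (hb : ∀ j, b j = X (B j)) :
    Module.finrank ℝ (latticeSpan (cocircuitLattice X)) = d := by
  have hspan : latticeSpan (cocircuitLattice X) =
      Submodule.span ℝ (Set.range (fun j => icast (fund X b j))) := by
    unfold latticeSpan
    apply le_antisymm
    · rw [Submodule.span_le]
      rintro _ ⟨v, hv, rfl⟩
      have : icast v = ∑ j, (v (B j) : ℝ) • icast (fund X b j) := by
        ext i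
        have := lattice_repr X hd hII b B hb v hv i
        simp only [icast, Finset.sum_apply, Pi.smul_apply, smul_eq_mul]
        conv_lhs => rw [this]
        push_cast
        rfl
      rw [this]
      exact Submodule.sum_mem _ fun j _ => Submodule.smul_mem _ _ (Submodule.subset_span ⟨j, rfl⟩)
    · apply Submodule.span_mono
      rintro _ ⟨j, rfl⟩
      exact ⟨_, AddSubgroup.subset_closure (fund_isCocircuit X b B hb j), rfl⟩
  have hli : LinearIndependent ℝ (fun j => icast (fund X b j)) := by
    rw [Fintype.linearIndependent_iff]
    intro c hc k
    have := congrFun hc (B k)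
    simpa [icast, fund_self X b B hb] using this
  rw [hspan, finrank_span_eq_card hli]
  simp

lemma zonotopal (hd : 2 ≤ d) (hX : Submodule.span ℝ (Set.range X) = ⊤) (hII : ConditionII X) :
    IsZonotopal (cocircuitLattice X) := by
  classical
  intro v hv hv0
  let P : Set (Fin d → Fin n) :=
    {B | ∃ b : Module.Basis (Fin d) ℝ (Fin d → ℝ), ∀ j, b j = X (B j)}
  obtain ⟨B, ⟨b, hb⟩, hmax⟩ := Set.exists_max_image P
    (fun B => (Finset.univ.filter (fun j => v (B j) = 0)).card) (Set.toFinite _) (exists_basis X hX)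
  have hex : ∃ j, v (B j) ≠ 0 := by
    by_contra hcon
    push Not at hcon
    apply hv0
    ext i
    rw [lattice_repr X hd hII b B hb v hv i]
    simp [hcon]
  obtain ⟨k, hk⟩ := hex
  have hcc := fund_isCocircuit X b B hb k
  refine ⟨fund X b k, ⟨AddSubgroup.subset_closure hcc, hcc.2.1, fun i => sgnR_cases _, ?_⟩, ?_⟩
  · intro u hu hu0 hsub
    have hrep : ∀ i, u i = u (B k) * fund X b k i := by
      intro i
      rw [lattice_repr X hd hII b B hb u hu i]
      apply Finset.sum_eq_single k
      · intro j _ hj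
        have : u (B j) = 0 := by
          by_contra h
          exact hsub.1 h (by rw [fund_self X b B hb, if_neg hj])
        rw [this, zero_mul]
      · simp
    apply hsub.2
    intro i hi h0
    rw [hrep, mul_eq_zero] at h0
    rcases h0 with h0 | h0
    · apply hu0
      ext i
      rw [hrep, h0]; simp
    · exact hi h0
  · intro i hi hvi
    have hki : b.coord k (X i) ≠ 0 := fun h => hi (sgnR_eq_zero.2 h)
    obtain ⟨b', hb', -, -⟩ := exchange X b B hb k i hki
    have hle := hmax (Function.update B k i) ⟨b', hb'⟩
    have hss : Finset.univ.filter (fun j => v (B j) = 0) ⊂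
        Finset.univ.filter (fun j => v (Function.update B k i j) = 0) := by
      rw [Finset.ssubset_iff_of_subset]
      · refine ⟨k, by simpa using hvi, by simpa using hk⟩
      · intro j hj
        simp only [Finset.mem_filter, Finset.mem_univ, true_and] at hj ⊢
        by_cases hjk : j = k
        · subst hjk; exact absurd hj hk
        · rw [Function.update_of_ne hjk]; exact hj
    have := Finset.card_lt_card hss
    omega

end

/-- If `X` spans `ℝ^d` (`d ≥ 2`) and satisfies McMullen's condition
(II), then the lattice generated by the cocircuits of `X` has rank `d` and is
zonotopal. -/
theorem conditionII_cocircuitLattice_zonotopal {n d : ℕ} (hd : 2 ≤ d)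
    (X : Fin n → Fin d → ℝ) (hX : Submodule.span ℝ (Set.range X) = ⊤)
    (hII : ConditionII X) :
    Module.finrank ℝ (latticeSpan (cocircuitLattice X)) = d ∧
    IsZonotopal (cocircuitLattice X) := by
  obtain ⟨B, b, hb⟩ := exists_basis X hX
  exact ⟨span_dim X hd hII b B hb, zonotopal X hd hX hII⟩
end

section
/- Let X = (x₁,…,xₙ) be a vector configuration of nonzero vectors spanning ℝ^d, d ≥ 2, and suppose the zonotope Z(X) tiles ℝ^d face-to-face by translations. Then every (d−2)-dimensional linear subspace of ℝ^d spanned by a subset of {x₁,…,xₙ} is contained in exactly 2 or 3 (d−1)-dimensional linear subspaces spanned by subsets of {x₁,…,xₙ}. -/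
namespace ZT

variable {n d : ℕ}

/-- Cone of feasible directions of `Z` at `q`. -/
def TC (Z : Set (Fin d → ℝ)) (q : Fin d → ℝ) : Set (Fin d → ℝ) :=
  {u | ∃ ε : ℝ, 0 < ε ∧ q + ε • u ∈ Z}

lemma zon_image (X : Fin n → Fin d → ℝ) :
    zonotope X = (Fintype.linearCombination ℝ X) '' (Metric.closedBall (0 : Fin n → ℝ) 1) := by
  ext z
  simp only [zonotope, Set.mem_ofPred_eq, Set.mem_image, mem_closedBall_zero_iff,
    Fintype.linearCombination_apply]
  constructor
  · rintro ⟨c, hc, rfl⟩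
    exact ⟨c, (pi_norm_le_iff_of_nonneg zero_le_one).2 hc, rfl⟩
  · rintro ⟨c, hc, rfl⟩
    exact ⟨c, (pi_norm_le_iff_of_nonneg zero_le_one).1 hc, rfl⟩

lemma zon_compact (X : Fin n → Fin d → ℝ) : IsCompact (zonotope X) := by
  rw [zon_image]
  exact (isCompact_closedBall _ _).image (LinearMap.continuous_of_finiteDimensional _)

lemma zon_convex (X : Fin n → Fin d → ℝ) : Convex ℝ (zonotope X) := by
  rw [zon_image]
  exact (convex_closedBall _ _).linear_image _

lemma zon_nhds (X : Fin n → Fin d → ℝ) (hX : Submodule.span ℝ (Set.range X) = ⊤) :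
    zonotope X ∈ nhds (0 : Fin d → ℝ) := by
  rw [zon_image]
  have hs : Function.Surjective (Fintype.linearCombination ℝ X) := by
    rw [← LinearMap.range_eq_top, Fintype.range_linearCombination, hX]
  have ho : IsOpenMap (Fintype.linearCombination ℝ X) :=
    LinearMap.isOpenMap_of_finiteDimensional _ hs
  have := ho.image_mem_nhds (Metric.closedBall_mem_nhds (0 : Fin n → ℝ) one_pos)
  simpa using this

lemma zon_neg (X : Fin n → Fin d → ℝ) {z} (hz : z ∈ zonotope X) : -z ∈ zonotope X := by
  obtain ⟨c, hc, rfl⟩ := hz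
  exact ⟨-c, by simpa using hc, by simp⟩

lemma zon_zero (X : Fin n → Fin d → ℝ) : (0 : Fin d → ℝ) ∈ zonotope X :=
  ⟨0, by simp, by simp⟩

lemma zon_shift (X : Fin n → Fin d → ℝ) (v : Fin d → ℝ)
    (h : ∀ z ∈ zonotope X, v + z ∈ zonotope X) : v = 0 := by
  have hk : ∀ k : ℕ, (k : ℝ) • v ∈ zonotope X := by
    intro k
    induction k with
    | zero => simpa using zon_zero X
    | succ k ih =>
      have := h _ ih
      convert this using 1
      push_cast
      rw [add_smul, one_smul, add_comm]
  obtain ⟨B, hB⟩ := (zon_compact X).isBounded.exists_norm_le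
  by_contra hv
  have hv' : 0 < ‖v‖ := norm_pos_iff.2 hv
  obtain ⟨k, hk'⟩ := exists_nat_gt (B / ‖v‖)
  have h1 := hB _ (hk k)
  rw [norm_smul, Real.norm_natCast] at h1
  rw [div_lt_iff₀ hv'] at hk'
  linarith

lemma TC_shrink {Z : Set (Fin d → ℝ)} (hZ : Convex ℝ Z) {q u : Fin d → ℝ} (hq : q ∈ Z)
    {ε δ : ℝ} (h0 : 0 < δ) (h1 : δ ≤ ε) (h : q + ε • u ∈ Z) : q + δ • u ∈ Z := by
  have hε : 0 < ε := h0.trans_le h1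
  have := hZ.add_smul_mem hq h (t := δ / ε) ⟨by positivity, (div_le_one hε).2 h1⟩
  rwa [smul_smul, div_mul_cancel₀ _ hε.ne'] at this

lemma TC_smul {Z : Set (Fin d → ℝ)} {q u : Fin d → ℝ} {c : ℝ} (hc : 0 < c)
    (h : u ∈ TC Z q) : c • u ∈ TC Z q := by
  obtain ⟨ε, h0, h⟩ := h
  refine ⟨ε / c, by positivity, ?_⟩
  rwa [smul_smul, div_mul_cancel₀ _ hc.ne']

lemma TC_smul_iff {Z : Set (Fin d → ℝ)} {q u : Fin d → ℝ} {c : ℝ} (hc : 0 < c) :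
    c • u ∈ TC Z q ↔ u ∈ TC Z q := by
  refine ⟨fun h => ?_, TC_smul hc⟩
  have := TC_smul (inv_pos.2 hc) h
  rwa [smul_smul, inv_mul_cancel₀ hc.ne', one_smul] at this

lemma TC_two {Z : Set (Fin d → ℝ)} (hZ : Convex ℝ Z) {q u v : Fin d → ℝ} (hq : q ∈ Z)
    {Z' : Set (Fin d → ℝ)} (hZ' : Convex ℝ Z') {q' : Fin d → ℝ} (hq' : q' ∈ Z')
    (hu : u ∈ TC Z q) (hv : v ∈ TC Z' q') :
    ∃ ε : ℝ, 0 < ε ∧ q + ε • u ∈ Z ∧ q' + ε • v ∈ Z' := by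
  obtain ⟨a, ha, hu⟩ := hu
  obtain ⟨b, hb, hv⟩ := hv
  exact ⟨min a b, lt_min ha hb, TC_shrink hZ hq (lt_min ha hb) (min_le_left _ _) hu,
    TC_shrink hZ' hq' (lt_min ha hb) (min_le_right _ _) hv⟩

lemma TC_add {Z : Set (Fin d → ℝ)} (hZ : Convex ℝ Z) {q u v : Fin d → ℝ} (hq : q ∈ Z)
    (hu : u ∈ TC Z q) (hv : v ∈ TC Z q) : u + v ∈ TC Z q := by
  obtain ⟨ε, h0, h1, h2⟩ := TC_two hZ hq hZ hq hu hv
  refine ⟨ε / 2, by positivity, ?_⟩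
  have := hZ h1 h2 (a := 1/2) (b := 1/2) (by norm_num) (by norm_num) (by norm_num)
  convert this using 1
  module

lemma TC_zero {Z : Set (Fin d → ℝ)} {q : Fin d → ℝ} (hq : q ∈ Z) : 0 ∈ TC Z q :=
  ⟨1, one_pos, by simpa using hq⟩

/-- a subspace inside the cone -/
lemma TC_span {Z : Set (Fin d → ℝ)} (hZ : Convex ℝ Z) {q : Fin d → ℝ} (hq : q ∈ Z)
    {A : Set (Fin d → ℝ)} (h : ∀ a ∈ A, a ∈ TC Z q ∧ -a ∈ TC Z q) :
    ∀ w ∈ Submodule.span ℝ A, w ∈ TC Z q ∧ -w ∈ TC Z q := by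
  intro w hw
  induction hw using Submodule.span_induction with
  | mem x hx => exact h x hx
  | zero => simpa using TC_zero hq
  | add x y _ _ hx hy =>
    refine ⟨TC_add hZ hq hx.1 hy.1, ?_⟩
    rw [neg_add]
    exact TC_add hZ hq hx.2 hy.2
  | smul c x _ hx =>
    rcases lt_trichotomy c 0 with hc | hc | hc
    · have hc' : 0 < -c := by linarith
      constructor
      · have := TC_smul hc' hx.2
        simpa using this
      · have := TC_smul hc' hx.1
        simpa using this
    · subst hc
      simpa using TC_zero hq
    · refine ⟨TC_smul hc hx.1, ?_⟩
      have := TC_smul hc hx.2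
      simpa using this

/-- each generator or its negative is a feasible direction -/
lemma TC_or (X : Fin n → Fin d → ℝ) {q : Fin d → ℝ} (hq : q ∈ zonotope X) (i : Fin n) :
    X i ∈ TC (zonotope X) q ∨ -X i ∈ TC (zonotope X) q := by
  obtain ⟨c, hc, rfl⟩ := hq
  rcases le_total (c i) 0 with h | h
  · left
    refine ⟨1, one_pos, c + Pi.single i 1, fun j => ?_, ?_⟩
    · have := abs_le.1 (hc j)
      rcases eq_or_ne j i with rfl | hj
      · simp only [Pi.add_apply, Pi.single_eq_same]
        exact abs_le.2 ⟨by linarith, by linarith⟩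
      · simpa [hj] using hc j
    · simp [add_smul, Finset.sum_add_distrib, Pi.single_apply, ite_smul]
  · right
    refine ⟨1, one_pos, c - Pi.single i 1, fun j => ?_, ?_⟩
    · have := abs_le.1 (hc j)
      rcases eq_or_ne j i with rfl | hj
      · simp only [Pi.sub_apply, Pi.single_eq_same]
        exact abs_le.2 ⟨by linarith, by linarith⟩
      · simpa [hj] using hc j
    · simp [sub_smul, Finset.sum_sub_distrib, Pi.single_apply, ite_smul]
      try abel

/-- the cone is generated by signed generators -/
lemma TC_gen (X : Fin n → Fin d → ℝ) {q : Fin d → ℝ} (hq : q ∈ zonotope X)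
    {u : Fin d → ℝ} (hu : u ∈ TC (zonotope X) q) (φ : (Fin d → ℝ) →ₗ[ℝ] ℝ) (hφ : 0 < φ u) :
    ∃ i, (X i ∈ TC (zonotope X) q ∧ 0 < φ (X i)) ∨ (-X i ∈ TC (zonotope X) q ∧ φ (X i) < 0) := by
  obtain ⟨c, hc, rfl⟩ := hq
  obtain ⟨ε, hε, c', hc', he⟩ := hu
  have h1 : ε * φ u = ∑ i, (c' i - c i) * φ (X i) := by
    have := congrArg φ he
    simp only [map_add, map_smul, map_sum, smul_eq_mul] at this
    simp only [sub_mul, Finset.sum_sub_distrib]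
    linarith
  have h2 : 0 < ∑ i, (c' i - c i) * φ (X i) := by rw [← h1]; positivity
  obtain ⟨i, -, hi⟩ := Finset.exists_lt_of_sum_lt (s := Finset.univ)
    (f := fun _ : Fin n => (0 : ℝ)) (g := fun i => (c' i - c i) * φ (X i)) (by simpa using h2)
  refine ⟨i, ?_⟩
  have a1 := abs_le.1 (hc i)
  have a2 := abs_le.1 (hc' i)
  rcases pos_and_pos_or_neg_and_neg_of_mul_pos hi with ⟨p1, p2⟩ | ⟨p1, p2⟩
  · left
    refine ⟨⟨1 - c i, by linarith, c + Pi.single i (1 - c i), fun j => ?_, ?_⟩, p2⟩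
    · rcases eq_or_ne j i with rfl | hj
      · simp
      · simpa [hj] using hc j
    · simp [add_smul, Finset.sum_add_distrib, Pi.single_apply, ite_smul]
  · right
    refine ⟨⟨1 + c i, by linarith, c - Pi.single i (1 + c i), fun j => ?_, ?_⟩, p2⟩
    · rcases eq_or_ne j i with rfl | hj
      · simp
      · simpa [hj] using hc j
    · simp [sub_smul, Finset.sum_sub_distrib, Pi.single_apply, ite_smul]
      try abel

/-- Face-to-face property in convenient form. -/
def FF (Z : Set (Fin d → ℝ)) (T : Set (Fin d → ℝ)) : Prop :=
  ∀ s ∈ T, ∀ t ∈ T, s ≠ t → ∀ p, p - s ∈ Z → p - t ∈ Z →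
    ∃ l : (Fin d → ℝ) →ₗ[ℝ] ℝ, (∀ y, y - s ∈ Z → l y ≤ l p) ∧
      (∀ y, y - s ∈ Z → l y = l p → y - t ∈ Z) ∧
      (∀ y, y - s ∈ Z → y - t ∈ Z → l y = l p)

lemma mem_tr {Z : Set (Fin d → ℝ)} {t x : Fin d → ℝ} : x ∈ (t + ·) '' Z ↔ x - t ∈ Z := by
  constructor
  · rintro ⟨z, hz, rfl⟩
    simpa using hz
  · intro h
    exact ⟨x - t, h, by simp⟩

lemma tiles_FF {Z : Set (Fin d → ℝ)} (h : TilesFaceToFace Z) :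
    ∃ T : Set (Fin d → ℝ), (∀ x, ∃ t ∈ T, x - t ∈ Z) ∧ FF Z T := by
  obtain ⟨T, hc, hf⟩ := h
  refine ⟨T, fun x => ?_, ?_⟩
  · obtain ⟨t, ht, h⟩ := hc x
    exact ⟨t, ht, mem_tr.1 h⟩
  · intro s hs t ht hst p hps hpt
    obtain ⟨l, hl⟩ := (hf s hs t ht hst).1 ⟨p, mem_tr.2 hps, mem_tr.2 hpt⟩
    have hm : ∀ y, (y - s ∈ Z ∧ y - t ∈ Z) ↔ (y - s ∈ Z ∧ ∀ x, x - s ∈ Z → l x ≤ l y) := by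
      intro y
      have := Set.ext_iff.1 hl y
      rw [Set.mem_inter_iff, mem_tr, mem_tr] at this
      rw [this]
      simp only [Set.mem_ofPred_eq, mem_tr]
    have hp := ((hm p).1 ⟨hps, hpt⟩).2
    refine ⟨l.toLinearMap, hp, ?_, ?_⟩
    · intro y hy he
      refine ((hm y).2 ⟨hy, fun x hx => ?_⟩).2
      have := hp x hx
      simp only [ContinuousLinearMap.coe_coe] at he
      rw [he]; exact this
    · intro y hy hy'
      exact le_antisymm (hp y hy) (((hm y).1 ⟨hy, hy'⟩).2 p hps)

lemma tile_eq (X : Fin n → Fin d → ℝ) {s t : Fin d → ℝ}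
    (h : ∀ y, y - s ∈ zonotope X → y - t ∈ zonotope X) : s = t := by
  have := zon_shift X (s - t) (fun z hz => by
    have := h (s + z) (by simpa using hz)
    convert this using 1
    abel)
  exact sub_eq_zero.1 this

lemma tile_close (X : Fin n → Fin d → ℝ) {T : Set (Fin d → ℝ)} (hT : FF (zonotope X) T)
    {s t : Fin d → ℝ} (hs : s ∈ T) (ht : t ∈ T) (h : s - t ∈ zonotope X) : s = t := by
  by_contra hne
  obtain ⟨l, h1, h2, -⟩ := hT s hs t ht hne s (by simpa using zon_zero X) h
  refine hne (tile_eq X fun y hy => h2 y hy (le_antisymm (h1 y hy) ?_))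
  have := h1 (s + s - y) (by convert zon_neg X hy using 1; abel)
  simp only [map_sub, map_add] at this
  linarith

/-- every direction at `p` is feasible for some tile at `p` -/
lemma cover (X : Fin n → Fin d → ℝ) (hX : Submodule.span ℝ (Set.range X) = ⊤)
    {T : Set (Fin d → ℝ)} (hc : ∀ x, ∃ t ∈ T, x - t ∈ zonotope X) (hT : FF (zonotope X) T)
    (p u : Fin d → ℝ) :
    ∃ t ∈ T, p - t ∈ zonotope X ∧ u ∈ TC (zonotope X) (p - t) := by
  let e : ℕ → ℝ := fun k => 1 / ((k : ℝ) + 1)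
  have he : Filter.Tendsto e Filter.atTop (nhds 0) := tendsto_one_div_add_atTop_nhds_zero_nat
  have hpe : Filter.Tendsto (fun k => p + e k • u) Filter.atTop (nhds p) := by
    simpa using (tendsto_const_nhds (x := p)).add (he.smul_const u)
  choose t htT htZ using fun k => hc (p + e k • u)
  obtain ⟨B, hB⟩ := (zon_compact X).isBounded.exists_norm_le
  obtain ⟨B', hB'⟩ := (Metric.isBounded_range_of_tendsto _ hpe).exists_norm_le
  have hb : ∀ k, t k ∈ Metric.closedBall (0 : Fin d → ℝ) (B' + B) := by
    intro k
    rw [mem_closedBall_zero_iff]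
    have h1 := hB _ (htZ k)
    have h2 := hB' _ (Set.mem_range_self k)
    calc ‖t k‖ = ‖(p + e k • u) - (p + e k • u - t k)‖ := by congr 1; abel
      _ ≤ _ := norm_sub_le _ _
      _ ≤ _ := add_le_add h2 h1
  obtain ⟨a, -, φ, hφ, hlim⟩ := (isCompact_closedBall (0 : Fin d → ℝ) (B' + B)).tendsto_subseq hb
  have hev : ∃ N, ∀ k ≥ N, t (φ k) = t (φ N) := by
    obtain ⟨r, hr, hball⟩ := Metric.mem_nhds_iff.1 (zon_nhds X hX)
    obtain ⟨N, hN⟩ := Metric.cauchySeq_iff'.1 hlim.cauchySeq r hr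
    refine ⟨N, fun k hk => tile_close X hT (htT _) (htT _) (hball ?_)⟩
    have := hN k hk
    simpa [dist_eq_norm] using this
  obtain ⟨N, hN⟩ := hev
  refine ⟨t (φ N), htT _, ?_, e (φ N), by positivity, ?_⟩
  · have h1 : Filter.Tendsto (fun k => p + e (φ k) • u - t (φ N)) Filter.atTop
        (nhds (p - t (φ N))) := (hpe.comp hφ.tendsto_atTop).sub_const _
    refine (zon_compact X).isClosed.mem_of_tendsto h1 ?_
    filter_upwards [Filter.eventually_ge_atTop N] with k hk
    rw [← hN k hk]
    exact htZ _
  · have := htZ (φ N)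
    convert this using 1
    abel

lemma combi {ι : Type*} (S : Finset ℝ) (A B : ι → ℝ → Prop)
    (h1 : ∀ t, ∀ s ∈ S, A t s ∨ B t s) (h2 : ∀ t, ∀ s ∈ S, A t s → B t s → False)
    (hA : ∀ t t', ∀ s ∈ S, ∀ s' ∈ S, s ≠ s' → A t s → A t s' → A t' s → A t' s' → t = t')
    (hB : ∀ t t', ∀ s ∈ S, ∀ s' ∈ S, s ≠ s' → B t s → B t s' → B t' s → B t' s' → t = t')
    (t0 : ι) (h0 : ∀ s ∈ S, A t0 s)
    (hj1 : ∀ a ∈ S, ∀ b ∈ S, a < b → (∀ s ∈ S, a ≤ s ∧ s ≤ b) → ∃ t, A t b ∧ B t a)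
    (hj2 : ∀ a ∈ S, ∀ b ∈ S, a < b → (∀ s ∈ S, s ≤ a ∨ b ≤ s) → ∃ t, B t a ∧ B t b) :
    S.card ≤ 3 := by
  by_contra hcard
  push Not at hcard
  have hne : S.Nonempty := Finset.card_pos.1 (by omega)
  set m := S.max' hne with hm
  set a := S.min' hne with ha
  have hmS : m ∈ S := S.max'_mem hne
  have haS : a ∈ S := S.min'_mem hne
  have hc1 : (S.erase m).card = S.card - 1 := Finset.card_erase_of_mem hmS
  have hne1 : (S.erase m).Nonempty := Finset.card_pos.1 (by omega)
  set b := (S.erase m).max' hne1 with hb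
  have hb' : b ∈ S.erase m := Finset.max'_mem _ hne1
  have hbS : b ∈ S := Finset.mem_of_mem_erase hb'
  have hbm : b ≠ m := Finset.ne_of_mem_erase hb'
  have hbm' : b < m := lt_of_le_of_ne (S.le_max' _ hbS) hbm
  have hab : a ≠ b := by
    intro hab
    have : (S.erase m) ⊆ {b} := by
      intro s hs
      rw [Finset.mem_singleton]
      refine le_antisymm (Finset.le_max' _ _ hs) ?_
      rw [← hab]
      exact S.min'_le _ (Finset.mem_of_mem_erase hs)
    have := Finset.card_le_card this
    rw [Finset.card_singleton] at this
    omega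
  have ham : a ≠ m := fun h => by
    have := S.min'_le _ hbS
    linarith
  obtain ⟨c, hc⟩ : (((S.erase m).erase b).erase a).Nonempty := by
    apply Finset.card_pos.1
    have e1 := Finset.pred_card_le_card_erase (s := (S.erase m).erase b) (a := a)
    have e2 := Finset.pred_card_le_card_erase (s := S.erase m) (a := b)
    omega
  simp only [Finset.mem_erase] at hc
  obtain ⟨hca, hcb, hcm, hcS⟩ := hc
  obtain ⟨t1, ht1m, ht1a⟩ := hj1 a haS m hmS (lt_of_le_of_ne (S.min'_le _ hmS) ham)
    (fun s hs => ⟨S.min'_le _ hs, S.le_max' _ hs⟩)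
  have key : ∀ s ∈ S, s ≠ m → B t1 s := by
    intro s hs hsm
    refine (h1 t1 s hs).resolve_left fun hAs => ?_
    have := hA t1 t0 s hs m hmS hsm hAs ht1m (h0 s hs) (h0 m hmS)
    rw [this] at ht1a
    exact h2 t0 a haS (h0 a haS) ht1a
  obtain ⟨t2, ht2b, ht2m⟩ := hj2 b hbS m hmS hbm' (fun s hs => by
    by_cases hsm : s = m
    · right; exact hsm.ge
    · left; exact Finset.le_max' _ _ (Finset.mem_erase.2 ⟨hsm, hs⟩))
  have key2 : ∀ s ∈ S, s ≠ m → s ≠ b → A t2 s := by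
    intro s hs hsm hsb
    refine (h1 t2 s hs).resolve_right fun hBs => ?_
    have := hB t2 t1 s hs b hbS hsb hBs ht2b (key s hs hsm) (key b hbS hbm)
    rw [this] at ht2m
    exact h2 t1 m hmS ht1m ht2m
  have := hA t2 t0 a haS c hcS (Ne.symm hca) (key2 a haS ham hab) (key2 c hcS hcm hcb)
    (h0 a haS) (h0 c hcS)
  rw [this] at ht2m
  exact h2 t0 m hmS (h0 m hmS) ht2m

/-- the base point, a vertex of the zonotope modulo `W` -/
noncomputable def p0 (X : Fin n → Fin d → ℝ) (f : (Fin d → ℝ) →ₗ[ℝ] ℝ) : Fin d → ℝ :=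
  ∑ i, (-Real.sign (f (X i))) • X i

lemma sign_abs_le (x : ℝ) : |(-Real.sign x)| ≤ 1 := by
  rcases lt_trichotomy x 0 with h | h | h
  · simp [Real.sign_of_neg h]
  · simp [h]
  · simp [Real.sign_of_pos h]

lemma p0_mem (X : Fin n → Fin d → ℝ) (f : (Fin d → ℝ) →ₗ[ℝ] ℝ) : p0 X f ∈ zonotope X :=
  ⟨_, fun i => sign_abs_le (f (X i)), rfl⟩

lemma p0_add (X : Fin n → Fin d → ℝ) (f : (Fin d → ℝ) →ₗ[ℝ] ℝ) (i : Fin n)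
    (hi : f (X i) = 0) : p0 X f + X i ∈ zonotope X ∧ p0 X f - X i ∈ zonotope X := by
  constructor
  · refine ⟨fun j => -Real.sign (f (X j)) + (Pi.single i 1 : Fin n → ℝ) j, fun j => ?_, ?_⟩
    · rcases eq_or_ne j i with rfl | hj
      · simp [hi]
      · simpa [hj] using sign_abs_le (f (X j))
    · simp [p0, add_smul, Finset.sum_add_distrib, Pi.single_apply, ite_smul]
  · refine ⟨fun j => -Real.sign (f (X j)) - (Pi.single i 1 : Fin n → ℝ) j, fun j => ?_, ?_⟩
    · rcases eq_or_ne j i with rfl | hj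
      · simp [hi]
      · simpa [hj] using sign_abs_le (f (X j))
    · simp [p0, sub_smul, Finset.sum_sub_distrib, Pi.single_apply, ite_smul]

lemma sign_term {x c : ℝ} (hc : |c| ≤ 1) :
    0 ≤ (c + Real.sign x) * x ∧ ((c + Real.sign x) * x = 0 → x ≠ 0 → c + Real.sign x = 0) := by
  have := abs_le.1 hc
  refine ⟨?_, fun h hx => (mul_eq_zero.1 h).resolve_right hx⟩
  rcases lt_trichotomy x 0 with h | h | h
  · rw [Real.sign_of_neg h]
    nlinarith
  · simp [h]
  · rw [Real.sign_of_pos h]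
    nlinarith

lemma p0_min (X : Fin n → Fin d → ℝ) (f g : (Fin d → ℝ) →ₗ[ℝ] ℝ)
    (hf : ∀ i, f (X i) = 0 → g (X i) = 0) {a : Fin d → ℝ} (ha : a ∈ zonotope X) :
    f (p0 X f) ≤ f a ∧ (f a = f (p0 X f) → g a = g (p0 X f)) := by
  obtain ⟨c, hc, rfl⟩ := ha
  have e : ∀ h : (Fin d → ℝ) →ₗ[ℝ] ℝ, h (∑ i, c i • X i) - h (p0 X f)
      = ∑ i, (c i + Real.sign (f (X i))) * h (X i) := by
    intro h
    simp only [p0, map_sum, map_smul, smul_eq_mul, ← Finset.sum_sub_distrib]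
    exact Finset.sum_congr rfl fun i _ => by ring
  have nn : ∀ i ∈ Finset.univ, 0 ≤ (c i + Real.sign (f (X i))) * f (X i) :=
    fun i _ => (sign_term (hc i)).1
  constructor
  · have := Finset.sum_nonneg nn
    rw [← e f] at this
    linarith
  · intro he
    have h0 : ∑ i, (c i + Real.sign (f (X i))) * f (X i) = 0 := by
      rw [← e f]; linarith
    rw [Finset.sum_eq_zero_iff_of_nonneg nn] at h0
    have : ∑ i, (c i + Real.sign (f (X i))) * g (X i) = 0 := by
      refine Finset.sum_eq_zero fun i hi => ?_
      by_cases hfi : f (X i) = 0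
      · rw [hf i hfi, mul_zero]
      · rw [(sign_term (hc i)).2 (h0 i hi) hfi, zero_mul]
    rw [← e g] at this
    linarith

/-- properties of every tile through `p` -/
lemma tile_props (X : Fin n → Fin d → ℝ)
    {T : Set (Fin d → ℝ)} (hT : FF (zonotope X) T) (f g : (Fin d → ℝ) →ₗ[ℝ] ℝ)
    (hf : ∀ i, f (X i) = 0 → g (X i) = 0) {t0 : Fin d → ℝ} (ht0 : t0 ∈ T)
    {t : Fin d → ℝ} (ht : t ∈ T) (hpt : t0 + p0 X f - t ∈ zonotope X) :
    (∀ i, f (X i) = 0 → t0 + p0 X f - t + X i ∈ zonotope X ∧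
      t0 + p0 X f - t - X i ∈ zonotope X) ∧
    ∀ u, t0 + p0 X f - t + u ∈ zonotope X → t0 + p0 X f - t - u ∈ zonotope X →
      f u = 0 ∧ g u = 0 := by
  have base : ∀ u, p0 X f + u ∈ zonotope X → p0 X f - u ∈ zonotope X → f u = 0 ∧ g u = 0 := by
    intro u h1 h2
    have a1 := p0_min X f g hf h1
    have a2 := p0_min X f g hf h2
    simp only [map_add, map_sub] at a1 a2
    have : f u = 0 := by linarith [a1.1, a2.1]
    refine ⟨this, ?_⟩
    have := a1.2 (by linarith)
    linarith
  by_cases htt : t = t0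
  · subst htt
    simp only [add_sub_cancel_left]
    exact ⟨fun i hi => p0_add X f i hi, base⟩
  · have hp0 : t0 + p0 X f - t0 ∈ zonotope X := by simpa using p0_mem X f
    obtain ⟨l, l1, l2, l3⟩ := hT t0 ht0 t ht (Ne.symm htt) _ hp0 hpt
    obtain ⟨l', k1, k2, k3⟩ := hT t ht t0 ht0 htt _ hpt hp0
    constructor
    · intro i hi
      obtain ⟨q1, q2⟩ := p0_add X f i hi
      have r1 : t0 + p0 X f + X i - t0 ∈ zonotope X := by convert q1 using 1; abel
      have r2 : t0 + p0 X f - X i - t0 ∈ zonotope X := by convert q2 using 1; abel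
      have s1 := l1 _ r1
      have s2 := l1 _ r2
      rw [map_add] at s1
      rw [map_sub] at s2
      have h0 : l (X i) = 0 := by linarith
      have u1 := l2 _ r1 (by rw [map_add l _ (X i), h0, add_zero])
      have u2 := l2 _ r2 (by rw [map_sub l _ (X i), h0, sub_zero])
      exact ⟨by convert u1 using 1; abel, by convert u2 using 1; abel⟩
    · intro u h1 h2
      have r1 : t0 + p0 X f + u - t ∈ zonotope X := by convert h1 using 1; abel
      have r2 : t0 + p0 X f - u - t ∈ zonotope X := by convert h2 using 1; abel
      have s1 := k1 _ r1
      have s2 := k1 _ r2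
      rw [map_add] at s1
      rw [map_sub] at s2
      have h0 : l' u = 0 := by linarith
      have u1 := k2 _ r1 (by rw [map_add l' _ u, h0, add_zero])
      have u2 := k2 _ r2 (by rw [map_sub l' _ u, h0, sub_zero])
      exact base u (by convert u1 using 1; abel) (by convert u2 using 1; abel)

lemma adj (X : Fin n → Fin d → ℝ) (f g : (Fin d → ℝ) →ₗ[ℝ] ℝ) {q : Fin d → ℝ}
    (hq : q ∈ zonotope X)
    (hcongr : ∀ u v, f u = f v → g u = g v → u ∈ TC (zonotope X) q → v ∈ TC (zonotope X) q)
    (a b : Fin d → ℝ) (ha : a ∈ TC (zonotope X) q ∨ -a ∈ TC (zonotope X) q)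
    (hb : b ∈ TC (zonotope X) q → -b ∈ TC (zonotope X) q → False)
    (hab : a + b ∈ TC (zonotope X) q) (α β : (Fin d → ℝ) →ₗ[ℝ] ℝ)
    (h1 : ∀ x, f x = α x * f a + β x * f b) (h2 : ∀ x, g x = α x * g a + β x * g b)
    (haa : α a = 1) (hba : α b = 0) (hi : ∀ i, α (X i) * β (X i) ≤ 0) :
    a ∈ TC (zonotope X) q := by
  by_contra hna
  have ha' := ha.resolve_left hna
  have hbC : b ∈ TC (zonotope X) q := by
    have := TC_add (zon_convex X) hq hab ha'
    convert this using 1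
    abel
  have key : ∀ z ∈ TC (zonotope X) q, 0 < α z → α z * β z ≤ 0 → False := by
    intro z hz hαz hz2
    have hβ : β z ≤ 0 := by
      by_contra h
      push Not at h
      have := mul_pos hαz h
      linarith
    rcases hβ.lt_or_eq with hβ | hβ
    · have s1 := TC_add (zon_convex X) hq hz (TC_smul hαz ha')
      have s2 : (-β z) • (-b) ∈ TC (zonotope X) q := by
        refine hcongr _ _ ?_ ?_ s1
        · simp only [map_add, map_smul, map_neg, smul_eq_mul, h1 z]; ring
        · simp only [map_add, map_smul, map_neg, smul_eq_mul, h2 z]; ring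
      exact hb hbC ((TC_smul_iff (by linarith)).1 s2)
    · have s2 : (α z) • a ∈ TC (zonotope X) q := by
        refine hcongr _ _ ?_ ?_ hz
        · rw [h1 z, hβ]; simp
        · rw [h2 z, hβ]; simp
      exact hna ((TC_smul_iff hαz).1 s2)
  obtain ⟨i, ⟨c1, c2⟩ | ⟨c1, c2⟩⟩ := TC_gen X hq hab α (by rw [map_add, haa, hba]; norm_num)
  · exact key _ c1 c2 (hi i)
  · exact key _ c1 (by rw [map_neg]; linarith) (by simpa using hi i)

open Classical in
lemma at_most_three (X : Fin n → Fin d → ℝ) (hX : Submodule.span ℝ (Set.range X) = ⊤)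
    {T : Set (Fin d → ℝ)} (hc : ∀ x, ∃ t ∈ T, x - t ∈ zonotope X) (hT : FF (zonotope X) T)
    (f g : (Fin d → ℝ) →ₗ[ℝ] ℝ) (hf : ∀ i, f (X i) = 0 → g (X i) = 0)
    (hW : ∀ w, f w = 0 → g w = 0 → w ∈ Submodule.span ℝ (X '' {i | f (X i) = 0}))
    (e1 e2 : Fin d → ℝ) (h11 : f e1 = 1) (h12 : g e1 = 0) (h21 : f e2 = 0) (h22 : g e2 = 1) :
    ((Finset.univ.filter fun i => f (X i) ≠ 0).image fun i => g (X i) / f (X i)).card ≤ 3 := by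
  obtain ⟨t0, ht0, -⟩ := hc 0
  set p := t0 + p0 X f with hp
  let ι := {t // t ∈ T ∧ p - t ∈ zonotope X}
  set R : ℝ → Fin d → ℝ := fun s => e1 + s • e2 with hR
  have fR : ∀ s, f (R s) = 1 := fun s => by simp [hR, h11, h21]
  have gR : ∀ s, g (R s) = s := fun s => by simp [hR, h12, h22]
  have hcv := zon_convex X
  have hWt : ∀ t : ι, ∀ w, f w = 0 → g w = 0 → w ∈ TC (zonotope X) (p - t.1) := by
    intro t w h1 h2
    refine (TC_span hcv t.2.2 ?_ w (hW w h1 h2)).1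
    rintro _ ⟨i, hi, rfl⟩
    have := (tile_props X hT f g hf ht0 t.2.1 t.2.2).1 i hi
    exact ⟨⟨1, one_pos, by simpa using this.1⟩, ⟨1, one_pos, by simpa [sub_eq_add_neg] using this.2⟩⟩
  have hext : ∀ t : ι, ∀ u, u ∈ TC (zonotope X) (p - t.1) → -u ∈ TC (zonotope X) (p - t.1) →
      f u = 0 ∧ g u = 0 := by
    intro t u h1 h2
    obtain ⟨ε, hε, k1, k2⟩ := TC_two hcv t.2.2 hcv t.2.2 h1 h2
    have := (tile_props X hT f g hf ht0 t.2.1 t.2.2).2 (ε • u) k1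
      (by convert k2 using 1; rw [smul_neg, sub_eq_add_neg])
    simpa [hε.ne'] using this
  have hcongr : ∀ t : ι, ∀ u v, f u = f v → g u = g v →
      u ∈ TC (zonotope X) (p - t.1) → v ∈ TC (zonotope X) (p - t.1) := by
    intro t u v h1 h2 hu
    have := TC_add hcv t.2.2 hu (hWt t (v - u) (by simp [h1]) (by simp [h2]))
    simpa using this
  have hshare : ∀ t t' : ι, ∀ u v, (∀ x, ∃ a b : ℝ, f x = a * f u + b * f v ∧
      g x = a * g u + b * g v) → u ∈ TC (zonotope X) (p - t.1) → v ∈ TC (zonotope X) (p - t.1) →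
      u ∈ TC (zonotope X) (p - t'.1) → v ∈ TC (zonotope X) (p - t'.1) → t = t' := by
    intro t t' u v hs hu hv hu' hv'
    by_contra hne
    have hne' : t.1 ≠ t'.1 := fun h => hne (Subtype.ext h)
    obtain ⟨l, l1, l2, l3⟩ := hT _ t.2.1 _ t'.2.1 hne' p t.2.2 t'.2.2
    have hz : ∀ u, u ∈ TC (zonotope X) (p - t.1) → u ∈ TC (zonotope X) (p - t'.1) → l u = 0 := by
      intro u h1 h2
      obtain ⟨ε, hε, k1, k2⟩ := TC_two hcv t.2.2 hcv t'.2.2 h1 h2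
      have := l3 (p + ε • u) (by convert k1 using 1; abel) (by convert k2 using 1; abel)
      simpa [hε.ne'] using this
    have hl : ∀ x, l x = 0 := by
      intro x
      obtain ⟨a, b, q1, q2⟩ := hs x
      have w1 : f (x - a • u - b • v) = 0 := by simp [q1]
      have w2 : g (x - a • u - b • v) = 0 := by simp [q2]
      have := hz _ (hWt t _ w1 w2) (hWt t' _ w1 w2)
      simpa [hz u hu hu', hz v hv hv'] using this
    exact hne' (tile_eq X fun y hy => l2 y hy (by rw [hl, hl]))
  set S := ((Finset.univ.filter fun i => f (X i) ≠ 0).image fun i => g (X i) / f (X i)) with hS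
  have hSi : ∀ i, f (X i) ≠ 0 → g (X i) / f (X i) ∈ S := fun i hi =>
    Finset.mem_image.2 ⟨i, by simpa using hi, rfl⟩
  have hgen : ∀ t : ι, ∀ s ∈ S, R s ∈ TC (zonotope X) (p - t.1) ∨
      -R s ∈ TC (zonotope X) (p - t.1) := by
    intro t s hs
    obtain ⟨i, hi, rfl⟩ := Finset.mem_image.1 hs
    have hi : f (X i) ≠ 0 := by simpa using hi
    have w : ∀ c : ℝ, c * f (X i) ≠ 0 → f (c • X i) = f ((c * f (X i)) • R (g (X i) / f (X i))) ∧
        g (c • X i) = g ((c * f (X i)) • R (g (X i) / f (X i))) := by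
      intro c _
      constructor
      · simp [fR]
      · simp only [map_smul, gR, smul_eq_mul]; field_simp
    have hor := TC_or X t.2.2 i
    have x1 : (1 : ℝ) • X i = X i := one_smul _ _
    have x2 : (-1 : ℝ) • X i = -X i := by simp
    rcases lt_or_gt_of_ne hi with hneg | hpos
    · rcases hor with h | h
      · right
        rw [← x1] at h
        have := hcongr t _ _ (w 1 (by simpa using hi)).1 (w 1 (by simpa using hi)).2 h
        rw [← TC_smul_iff (c := -f (X i)) (by linarith)]
        simpa using this
      · left
        rw [← x2] at h
        have := hcongr t _ _ (w (-1) (by simpa using hi)).1 (w (-1) (by simpa using hi)).2 h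
        rw [← TC_smul_iff (c := -f (X i)) (by linarith)]
        simpa using this
    · rcases hor with h | h
      · left
        rw [← x1] at h
        have := hcongr t _ _ (w 1 (by simpa using hi)).1 (w 1 (by simpa using hi)).2 h
        rw [← TC_smul_iff (c := f (X i)) hpos]
        simpa using this
      · right
        rw [← x2] at h
        have := hcongr t _ _ (w (-1) (by simpa using hi)).1 (w (-1) (by simpa using hi)).2 h
        rw [← TC_smul_iff (c := f (X i)) hpos]
        simpa using this
  have hpt : ∀ t : ι, ∀ s, R s ∈ TC (zonotope X) (p - t.1) →
      -R s ∈ TC (zonotope X) (p - t.1) → False := by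
    intro t s h1 h2
    have := (hext t _ h1 h2).1
    rw [fR] at this
    norm_num at this
  have hsolve : ∀ s s' : ℝ, s ≠ s' → ∀ x, ∃ a b : ℝ, f x = a * f (R s) + b * f (R s') ∧
      g x = a * g (R s) + b * g (R s') := by
    intro s s' hne x
    have : s - s' ≠ 0 := sub_ne_zero.2 hne
    refine ⟨(g x - s' * f x) / (s - s'), (s * f x - g x) / (s - s'), ?_, ?_⟩
    · rw [fR, fR]; field_simp; ring
    · rw [gR, gR]; field_simp; ring
  have hfac : ∀ i, ∀ a b : ℝ, (∀ s ∈ S, (s - a) * (s - b) ≤ 0) →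
      (g (X i) - a * f (X i)) * (g (X i) - b * f (X i)) ≤ 0 := by
    intro i a b h
    by_cases hi : f (X i) = 0
    · simp [hi, hf i hi]
    · have := h _ (hSi i hi)
      have e : (g (X i) - a * f (X i)) * (g (X i) - b * f (X i)) =
        (f (X i)) ^ 2 * ((g (X i) / f (X i) - a) * (g (X i) / f (X i) - b)) := by
        field_simp
      rw [e]
      exact mul_nonpos_of_nonneg_of_nonpos (sq_nonneg _) this
  have hfac' : ∀ i, ∀ a b : ℝ, (∀ s ∈ S, 0 ≤ (s - a) * (s - b)) →
      0 ≤ (g (X i) - a * f (X i)) * (g (X i) - b * f (X i)) := by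
    intro i a b h
    by_cases hi : f (X i) = 0
    · simp [hi, hf i hi]
    · have := h _ (hSi i hi)
      have e : (g (X i) - a * f (X i)) * (g (X i) - b * f (X i)) =
        (f (X i)) ^ 2 * ((g (X i) / f (X i) - a) * (g (X i) / f (X i) - b)) := by
        field_simp
      rw [e]
      exact mul_nonneg (sq_nonneg _) this
  refine combi (ι := ι) S (fun t s => R s ∈ TC (zonotope X) (p - t.1))
    (fun t s => -R s ∈ TC (zonotope X) (p - t.1)) hgen (fun t s _ => hpt t s) ?_ ?_
    ⟨t0, ht0, by simpa [hp] using p0_mem X f⟩ ?_ ?_ ?_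
  · intro t t' s _ s' _ hne h1 h2 h3 h4
    exact hshare t t' _ _ (hsolve s s' hne) h1 h2 h3 h4
  · intro t t' s _ s' _ hne h1 h2 h3 h4
    refine hshare t t' _ _ (fun x => ?_) h1 h2 h3 h4
    obtain ⟨a, b, q1, q2⟩ := hsolve s s' hne x
    exact ⟨-a, -b, by simpa using q1, by simpa using q2⟩
  · intro s hs
    refine (hgen ⟨t0, ht0, by simpa [hp] using p0_mem X f⟩ s hs).resolve_right ?_
    rintro ⟨ε, hε, h⟩
    have h' : p0 X f + ε • -R s ∈ zonotope X := by simpa [hp] using h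
    have := (p0_min X f g hf h').1
    simp only [map_add, map_smul, map_neg, fR, smul_eq_mul] at this
    linarith
  · intro a ha b hb hab hall
    obtain ⟨t, htT, htp, ht⟩ := cover X hX hc hT p (R b + -R a)
    have hba : b - a ≠ 0 := by linarith
    have ht' : -R a + R b ∈ TC (zonotope X) (p - t) := by rwa [add_comm] at ht
    let α : (Fin d → ℝ) →ₗ[ℝ] ℝ := (b - a)⁻¹ • (g - a • f)
    let β : (Fin d → ℝ) →ₗ[ℝ] ℝ := (b - a)⁻¹ • (g - b • f)
    have hα : ∀ x, α x = (b - a)⁻¹ * (g x - a * f x) := fun x => by simp [α]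
    have hβ : ∀ x, β x = (b - a)⁻¹ * (g x - b * f x) := fun x => by simp [β]
    have hsign : ∀ i, α (X i) * β (X i) ≤ 0 := by
      intro i
      rw [hα, hβ]
      have := hfac i a b fun s hs => by
        have := hall s hs
        exact mul_nonpos_of_nonneg_of_nonpos (by linarith) (by linarith)
      have e := mul_nonpos_of_nonneg_of_nonpos (sq_nonneg (b - a)⁻¹) this
      linarith
    let τ : ι := ⟨t, htT, htp⟩
    refine ⟨τ, ?_, ?_⟩
    · refine adj X f g htp (hcongr τ) (R b) (-R a) (hgen τ b hb)
        (fun h1 h2 => hpt τ a (by simpa using h2) h1) ht α β ?_ ?_ ?_ ?_ hsign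
      · intro x; rw [hα, hβ, map_neg, fR, fR]; field_simp; ring
      · intro x; rw [hα, hβ, map_neg, gR, gR]; field_simp; ring
      · rw [hα, fR, gR]; field_simp
      · rw [hα, map_neg, map_neg, fR, gR]; ring
    · refine adj X f g htp (hcongr τ) (-R a) (R b) (by rw [neg_neg]; exact (hgen τ a ha).symm)
        (fun h1 h2 => hpt τ b h1 h2) ht' β α ?_ ?_ ?_ ?_
        (fun i => by rw [mul_comm]; exact hsign i)
      · intro x; rw [hα, hβ, map_neg, fR, fR]; field_simp; ring
      · intro x; rw [hα, hβ, map_neg, gR, gR]; field_simp; ring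
      · rw [hβ, map_neg, map_neg, fR, gR]; field_simp; ring
      · rw [hβ, fR, gR]; ring
  · intro a ha b hb hab hall
    obtain ⟨t, htT, htp, ht⟩ := cover X hX hc hT p (-R a + -R b)
    have hba : b - a ≠ 0 := by linarith
    have ht' : -R b + -R a ∈ TC (zonotope X) (p - t) := by rwa [add_comm] at ht
    let α : (Fin d → ℝ) →ₗ[ℝ] ℝ := (b - a)⁻¹ • (g - b • f)
    let β : (Fin d → ℝ) →ₗ[ℝ] ℝ := (-(b - a)⁻¹) • (g - a • f)
    have hα : ∀ x, α x = (b - a)⁻¹ * (g x - b * f x) := fun x => by simp [α]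
    have hβ : ∀ x, β x = -(b - a)⁻¹ * (g x - a * f x) := fun x => by simp [β]
    have hsign : ∀ i, α (X i) * β (X i) ≤ 0 := by
      intro i
      rw [hα, hβ]
      have := hfac' i a b fun s hs => by
        rcases hall s hs with h | h
        · exact mul_nonneg_of_nonpos_of_nonpos (by linarith) (by linarith)
        · exact mul_nonneg (by linarith) (by linarith)
      have e := mul_nonneg (sq_nonneg (b - a)⁻¹) this
      linarith
    let τ : ι := ⟨t, htT, htp⟩
    refine ⟨τ, ?_, ?_⟩
    · refine adj X f g htp (hcongr τ) (-R a) (-R b) (by rw [neg_neg]; exact (hgen τ a ha).symm)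
        (fun h1 h2 => hpt τ b (by simpa using h2) h1) ht α β ?_ ?_ ?_ ?_ hsign
      · intro x; rw [hα, hβ, map_neg, map_neg, fR, fR]; field_simp; ring
      · intro x; rw [hα, hβ, map_neg, map_neg, gR, gR]; field_simp; ring
      · rw [hα, map_neg, map_neg, fR, gR]; field_simp; ring
      · rw [hα, map_neg, map_neg, fR, gR]; ring
    · refine adj X f g htp (hcongr τ) (-R b) (-R a) (by rw [neg_neg]; exact (hgen τ b hb).symm)
        (fun h1 h2 => hpt τ a (by simpa using h2) h1) ht' β α ?_ ?_ ?_ ?_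
        (fun i => by rw [mul_comm]; exact hsign i)
      · intro x; rw [hα, hβ, map_neg, map_neg, fR, fR]; field_simp; ring
      · intro x; rw [hα, hβ, map_neg, map_neg, gR, gR]; field_simp; ring
      · rw [hβ, map_neg, map_neg, fR, gR]; field_simp; ring
      · rw [hβ, map_neg, map_neg, fR, gR]; ring

/-- generic functionals cutting out a codimension two subspace -/
lemma exists_fg (hd : 2 ≤ d) (X : Fin n → Fin d → ℝ) (W : Submodule ℝ (Fin d → ℝ))
    (hW : Module.finrank ℝ W = d - 2) :
    ∃ (f g : (Fin d → ℝ) →ₗ[ℝ] ℝ) (e1 e2 : Fin d → ℝ), f e1 = 1 ∧ g e1 = 0 ∧ f e2 = 0 ∧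
      g e2 = 1 ∧ (∀ x, x ∈ W ↔ f x = 0 ∧ g x = 0) ∧ ∀ i, f (X i) = 0 → g (X i) = 0 := by
  have hq : Module.finrank ℝ ((Fin d → ℝ) ⧸ W) = 2 := by
    have := W.finrank_quotient_add_finrank
    rw [hW, Module.finrank_fin_fun] at this
    omega
  let b := Module.finBasisOfFinrankEq ℝ ((Fin d → ℝ) ⧸ W) hq
  let f0 : (Fin d → ℝ) →ₗ[ℝ] ℝ := (b.coord 0).comp W.mkQ
  let g : (Fin d → ℝ) →ₗ[ℝ] ℝ := (b.coord 1).comp W.mkQ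
  obtain ⟨v0, hv0⟩ := W.mkQ_surjective (b 0)
  obtain ⟨v1, hv1⟩ := W.mkQ_surjective (b 1)
  have a1 : f0 v0 = 1 := by simp only [f0, LinearMap.comp_apply, hv0]; simp
  have a2 : f0 v1 = 0 := by simp only [f0, LinearMap.comp_apply, hv1]; simp
  have a3 : g v0 = 0 := by simp only [g, LinearMap.comp_apply, hv0]; simp
  have a4 : g v1 = 1 := by simp only [g, LinearMap.comp_apply, hv1]; simp
  have hker : ∀ x, x ∈ W ↔ f0 x = 0 ∧ g x = 0 := by
    intro x
    rw [← Submodule.Quotient.mk_eq_zero, ← b.forall_coord_eq_zero_iff, Fin.forall_fin_two]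
    rfl
  obtain ⟨c, hc⟩ := Infinite.exists_notMem_finset
    (Finset.univ.image fun i => -f0 (X i) / g (X i))
  refine ⟨f0 + c • g, g, v0, v1 - c • v0, by simp [a1, a3], a3, by simp [a1, a2, a3, a4],
    by simp [a3, a4], fun x => ?_, fun i hi => ?_⟩
  · rw [hker]
    constructor
    · rintro ⟨h1, h2⟩; simp [h1, h2]
    · rintro ⟨h1, h2⟩; simpa [h2] using h1
  · by_contra hg
    apply hc
    refine Finset.mem_image.2 ⟨i, Finset.mem_univ _, ?_⟩
    simp only [LinearMap.add_apply, LinearMap.smul_apply, smul_eq_mul] at hi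
    rw [div_eq_iff hg]
    linarith

open Classical in
lemma count (hd : 2 ≤ d) (X : Fin n → Fin d → ℝ) (W : Submodule ℝ (Fin d → ℝ))
    (hW : Module.finrank ℝ W = d - 2) (hWs : W = Submodule.span ℝ (X '' {i | X i ∈ W}))
    (f g : (Fin d → ℝ) →ₗ[ℝ] ℝ)
    (e1 e2 : Fin d → ℝ) (h11 : f e1 = 1) (h12 : g e1 = 0) (h21 : f e2 = 0) (h22 : g e2 = 1)
    (hk : ∀ x, x ∈ W ↔ f x = 0 ∧ g x = 0) (hf : ∀ i, f (X i) = 0 → g (X i) = 0) :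
    {H : Submodule ℝ (Fin d → ℝ) |
        SpannedSubspace X H ∧ Module.finrank ℝ H = d - 1 ∧ W ≤ H}.ncard =
    ((Finset.univ.filter fun i => f (X i) ≠ 0).image fun i => g (X i) / f (X i)).card := by
  set S := ((Finset.univ.filter fun i => f (X i) ≠ 0).image fun i => g (X i) / f (X i)) with hS
  let K : ℝ → Submodule ℝ (Fin d → ℝ) := fun s => LinearMap.ker (g - s • f)
  have hK : ∀ s x, x ∈ K s ↔ g x = s * f x := by
    intro s x
    simp [K, sub_eq_zero]
  have hKr : ∀ s, Module.finrank ℝ (K s) = d - 1 := by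
    intro s
    have hs : LinearMap.range (g - s • f) = ⊤ := by
      rw [LinearMap.range_eq_top]
      intro y
      exact ⟨y • e2, by simp [h21, h22]⟩
    have := LinearMap.finrank_range_add_finrank_ker (g - s • f)
    rw [hs, finrank_top, Module.finrank_self, Module.finrank_fin_fun] at this
    change 1 + Module.finrank ℝ (K s) = d at this
    omega
  have hWK : ∀ s, W ≤ K s := by
    intro s x hx
    rw [hK]
    obtain ⟨h1, h2⟩ := (hk x).1 hx
    simp [h1, h2]
  have hKle : ∀ (i : Fin n) (H : Submodule ℝ (Fin d → ℝ)), f (X i) ≠ 0 → W ≤ H → X i ∈ H →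
      K (g (X i) / f (X i)) ≤ H := by
    intro i H hi hWH hXH x hx
    rw [hK] at hx
    have : x - (f x / f (X i)) • X i ∈ W := by
      rw [hk]
      constructor
      · simp only [map_sub, map_smul, smul_eq_mul]; field_simp; ring
      · simp only [map_sub, map_smul, smul_eq_mul, hx]; field_simp; ring
    have := H.add_mem (hWH this) (H.smul_mem (f x / f (X i)) hXH)
    simpa using this
  have himg : {H : Submodule ℝ (Fin d → ℝ) |
        SpannedSubspace X H ∧ Module.finrank ℝ H = d - 1 ∧ W ≤ H} = K '' (S : Set ℝ) := by
    ext H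
    simp only [Set.mem_ofPred_eq, Set.mem_image, Finset.mem_coe]
    constructor
    · rintro ⟨⟨S1, hS1⟩, hr, hWH⟩
      have : ∃ i ∈ S1, X i ∉ W := by
        by_contra hcon
        push Not at hcon
        have : H ≤ W := by
          rw [hS1, Submodule.span_le]
          rintro _ ⟨i, hi, rfl⟩
          exact hcon i hi
        have := Submodule.finrank_mono this
        omega
      obtain ⟨i, hi1, hiW⟩ := this
      have hfi : f (X i) ≠ 0 := fun h => hiW ((hk _).2 ⟨h, hf i h⟩)
      refine ⟨g (X i) / f (X i), Finset.mem_image.2 ⟨i, by simpa using hfi, rfl⟩, ?_⟩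
      apply Submodule.eq_of_le_of_finrank_eq
      · refine hKle i H hfi hWH ?_
        rw [hS1]
        exact Submodule.subset_span ⟨i, hi1, rfl⟩
      · rw [hKr, hr]
    · rintro ⟨s, hs, rfl⟩
      refine ⟨⟨{j | X j ∈ K s}, ?_⟩, hKr s, hWK s⟩
      obtain ⟨i, hi, rfl⟩ := Finset.mem_image.1 hs
      have hi : f (X i) ≠ 0 := by simpa using hi
      have hXi : X i ∈ K (g (X i) / f (X i)) := by rw [hK]; field_simp
      apply le_antisymm
      · refine hKle i _ hi ?_ (Submodule.subset_span ⟨i, hXi, rfl⟩)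
        conv_lhs => rw [hWs]
        exact Submodule.span_mono (Set.image_mono fun j hj => hWK _ hj)
      · rw [Submodule.span_le]
        rintro _ ⟨j, hj, rfl⟩
        exact hj
  rw [himg, Set.ncard_image_of_injOn, Set.ncard_coe_finset]
  intro s _ s' _ he
  have : e1 + s • e2 ∈ K s := by rw [hK]; simp [h11, h12, h21, h22]
  rw [show K s = K s' from he, hK] at this
  simpa [h11, h12, h21, h22] using this

open Classical in
lemma at_least_two (X : Fin n → Fin d → ℝ) (hX : Submodule.span ℝ (Set.range X) = ⊤)
    (f g : (Fin d → ℝ) →ₗ[ℝ] ℝ) (e2 : Fin d → ℝ) (h21 : f e2 = 0) (h22 : g e2 = 1)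
    (hf : ∀ i, f (X i) = 0 → g (X i) = 0) :
    2 ≤ ((Finset.univ.filter fun i => f (X i) ≠ 0).image fun i => g (X i) / f (X i)).card := by
  set S := ((Finset.univ.filter fun i => f (X i) ≠ 0).image fun i => g (X i) / f (X i)) with hS
  by_contra hcon
  have hle : S.card ≤ 1 := by omega
  have : ∃ s, ∀ x ∈ S, x = s := by
    rcases S.eq_empty_or_nonempty with h | ⟨s, hs⟩
    · exact ⟨0, by simp [h]⟩
    · exact ⟨s, fun x hx => Finset.card_le_one.1 hle x hx s hs⟩
  obtain ⟨s, hs⟩ := this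
  have h : Submodule.span ℝ (Set.range X) ≤ LinearMap.ker (g - s • f) := by
    rw [Submodule.span_le]
    rintro _ ⟨i, rfl⟩
    simp only [SetLike.mem_coe, LinearMap.mem_ker, LinearMap.sub_apply, LinearMap.smul_apply,
      smul_eq_mul]
    by_cases hi : f (X i) = 0
    · simp [hi, hf i hi]
    · have := hs _ (Finset.mem_image.2 ⟨i, by simpa using hi, rfl⟩)
      rw [← this]
      field_simp
      ring
  rw [hX] at h
  have := h (Submodule.mem_top (x := e2))
  simp [h21, h22] at this

end ZT

/-- If the zonotope of a configuration `X` of nonzero vectors spanning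
`ℝ^d` (`d ≥ 2`) tiles space face-to-face by translations, then `X` satisfies
McMullen's condition (II). -/
theorem tiling_implies_conditionII {n d : ℕ} (hd : 2 ≤ d)
    (X : Fin n → Fin d → ℝ) (hX0 : ∀ i, X i ≠ 0)
    (hX : Submodule.span ℝ (Set.range X) = ⊤)
    (htile : TilesFaceToFace (zonotope X)) :
    ConditionII X := by 
  classical
  intro W hWS hW
  obtain ⟨S0, hS0⟩ := hWS
  obtain ⟨T, hc, hT⟩ := ZT.tiles_FF htile
  obtain ⟨f, g, e1, e2, h11, h12, h21, h22, hk, hf⟩ := ZT.exists_fg hd X W hW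
  have hWs : W = Submodule.span ℝ (X '' {i | X i ∈ W}) := by
    apply le_antisymm
    · conv_lhs => rw [hS0]
      refine Submodule.span_mono (Set.image_mono fun i hi => ?_)
      change X i ∈ W
      rw [hS0]
      exact Submodule.subset_span ⟨i, hi, rfl⟩
    · rw [Submodule.span_le]
      rintro _ ⟨j, hj, rfl⟩
      exact hj
  have hset : {i | X i ∈ W} = {i | f (X i) = 0} := by
    ext i
    exact ⟨fun h => ((hk _).1 h).1, fun h => (hk _).2 ⟨h, hf i h⟩⟩
  have h3 := ZT.at_most_three X hX hc hT f g hf (fun w h1 h2 => by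
    rw [← hset, ← hWs]
    exact (hk w).2 ⟨h1, h2⟩) e1 e2 h11 h12 h21 h22
  have h2 := ZT.at_least_two X hX f g e2 h21 h22 hf
  rw [ZT.count hd X W hW hWs f g e1 e2 h11 h12 h21 h22 hk hf]
  omega
end
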